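/- Let H be an MC-history. Let MCSG*(H) denote the transitive closure of the MC-serializability graph of H, and let MVSG*(MV(H)) denote the transitive closure of the multiversion serializability graph of MV(H) taken with respect to any write version order. Then the two graphs are identical: MCSG*(H) = MVSG*(MV(H)). -/

import Mathlib

/-! ## Formalization of MC-transactions and MC-histories
(Pfeifer & Lockemann, "Theory and Practice of Transactional Method Caching") -/

/-- Types of operations: read, write, method, commit, abort. -/
inductive OpKind : Type where
  | r | w | m | c | a
deriving DecidableEq

/-- Operations of MC-histories over data elements of type `D`:
`read i j x` is `r_i^j[x]`, `write i x` is `w_i[x]`, `meth i k l` is `m_i^{k,l}`,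
`commit i` is `c_i` and `abort i` is `a_i`. -/
inductive MCOp (D : Type) : Type where
  | read  (i j : ℕ) (x : D)
  | write (i : ℕ) (x : D)
  | meth  (i k l : ℕ)
  | commit (i : ℕ)
  | abort (i : ℕ)

namespace MCOp
variable {D : Type}

/-- The index of the transaction an operation belongs to. -/
def tx : MCOp D → ℕ
  | read i _ _ => i
  | write i _ => i
  | meth i _ _ => i
  | commit i => i
  | abort i => i

/-- The type `a(p)` of an operation. -/
def kind : MCOp D → OpKind
  | read _ _ _ => .r
  | write _ _ => .w
  | meth _ _ _ => .m
  | commit _ => .c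
  | abort _ => .a

end MCOp

/-- The set `d(p)` of data elements of an operation (relative to a history's operation set,
which is needed for method operations). -/
def dset {D : Type} (ops : Set (MCOp D)) : MCOp D → Set D
  | .read _ _ x => {x}
  | .write _ x => {x}
  | .meth _ k l => {x | MCOp.read k l x ∈ ops}
  | .commit _ => ∅
  | .abort _ => ∅

/-- Two operations conflict (`u ∦ v`). -/
def conflict {D : Type} (ops : Set (MCOp D)) (p q : MCOp D) : Prop :=
  (dset ops p ∩ dset ops q).Nonempty ∧
  ((p.tx ≠ q.tx ∧ (p.kind = OpKind.w ∨ q.kind = OpKind.w)) ∨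
   (p.kind = OpKind.w ∧ q.kind = OpKind.m) ∨
   (p.kind = OpKind.m ∧ q.kind = OpKind.w))

theorem dset_nonmeth {D : Type} (ops1 ops2 : Set (MCOp D)) (p : MCOp D)
    (h : p.kind ≠ OpKind.m) : dset ops1 p = dset ops2 p := by
  cases p <;> simp [dset, MCOp.kind] at *

theorem conflict_nonmeth {D : Type} (ops1 ops2 : Set (MCOp D)) (p q : MCOp D)
    (hp : p.kind ≠ OpKind.m) (hq : q.kind ≠ OpKind.m) :
    conflict ops1 p q → conflict ops2 p q := by
  rintro ⟨h1, h2⟩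
  refine ⟨?_, h2⟩
  rwa [dset_nonmeth ops1 ops2 p hp, dset_nonmeth ops1 ops2 q hq] at h1

/-- A (well defined) MC-history `H` over MC-transactions `T_1, …, T_n`.
The transaction `T_i` is the set of operations `p ∈ ops` with `p.tx = i`;
`lt` is the partial order `<` of the history (by `lt_mem` it only relates
operations of the history and it restricts to the orders `<_i`). -/
structure MCHistory (D : Type) : Type where
  /-- number of transactions -/
  n : ℕ
  /-- the operations of the history -/
  ops : Set (MCOp D)
  /-- the partial ordering relation `<` -/
  lt : MCOp D → MCOp D → Prop
  tx_mem : ∀ p ∈ ops, 1 ≤ p.tx ∧ p.tx ≤ n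
  lt_irrefl : ∀ p, ¬ lt p p
  lt_trans : ∀ p q r, lt p q → lt q r → lt p r
  lt_mem : ∀ p q, lt p q → p ∈ ops ∧ q ∈ ops
  /-- `a_i ∈ T_i ↔ c_i ∉ T_i` -/
  abort_commit : ∀ i, 1 ≤ i → i ≤ n → (MCOp.abort i ∈ ops ↔ MCOp.commit i ∉ ops)
  /-- every non-termination operation precedes `a_i` or `c_i` -/
  terminate : ∀ p ∈ ops, p.kind ≠ OpKind.c → p.kind ≠ OpKind.a →
      lt p (MCOp.abort p.tx) ∨ lt p (MCOp.commit p.tx)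
  /-- `r_i^j[x] <_i w_i[x] ↔ ¬ (w_i[x] <_i r_i^j[x])` -/
  rw_order : ∀ (i j : ℕ) (x : D), MCOp.read i j x ∈ ops → MCOp.write i x ∈ ops →
      (lt (MCOp.read i j x) (MCOp.write i x) ↔ ¬ lt (MCOp.write i x) (MCOp.read i j x))
  /-- for `m_i^{k,l} ∈ H`, `k ∈ {1,…,n}` -/
  meth_range : ∀ i k l, MCOp.meth i k l ∈ ops → 1 ≤ k ∧ k ≤ n
  /-- for `m_i^{k,l} ∈ H`, every `r_k^l[x] ∈ H` satisfies `r_k^l[x] < m_i^{k,l}` -/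
  meth_reads : ∀ i k l, MCOp.meth i k l ∈ ops → ∀ x : D, MCOp.read k l x ∈ ops →
      lt (MCOp.read k l x) (MCOp.meth i k l)
  /-- well definedness: conflicting operations are ordered -/
  well_defined : ∀ p ∈ ops, ∀ q ∈ ops, conflict ops p q → lt p q ∨ lt q p

namespace MCHistory
variable {D : Type}

/-- The rw-projection `RW(H)`: all operations of `H` except method operations,
with the order restricted accordingly. -/
def RW (H : MCHistory D) : MCHistory D where
  n := H.n
  ops := {p | p ∈ H.ops ∧ p.kind ≠ OpKind.m}
  lt := fun p q => H.lt p q ∧ p.kind ≠ OpKind.m ∧ q.kind ≠ OpKind.m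
  tx_mem := fun p hp => H.tx_mem p hp.1
  lt_irrefl := fun p h => H.lt_irrefl p h.1
  lt_trans := fun p q r h1 h2 => ⟨H.lt_trans p q r h1.1 h2.1, h1.2.1, h2.2.2⟩
  lt_mem := fun p q h => ⟨⟨(H.lt_mem p q h.1).1, h.2.1⟩, (H.lt_mem p q h.1).2, h.2.2⟩
  abort_commit := by
    intro i h1 h2
    have h := H.abort_commit i h1 h2
    constructor
    · intro hp hc
      exact (h.mp hp.1) hc.1
    · intro hp
      refine ⟨h.mpr fun hc => hp ⟨hc, ?_⟩, ?_⟩ <;> simp [MCOp.kind]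
  terminate := by
    intro p hp hc ha
    rcases H.terminate p hp.1 hc ha with h | h
    · exact Or.inl ⟨h, hp.2, by simp [MCOp.kind]⟩
    · exact Or.inr ⟨h, hp.2, by simp [MCOp.kind]⟩
  rw_order := by
    intro i j x hr hw
    have h := H.rw_order i j x hr.1 hw.1
    constructor
    · intro hlt hlt2
      exact (h.mp hlt.1) hlt2.1
    · intro hlt
      refine ⟨h.mpr fun h2 => hlt ⟨h2, ?_, ?_⟩, ?_, ?_⟩ <;> simp [MCOp.kind]
  meth_range := by
    intro i k l hm
    exact absurd rfl hm.2
  meth_reads := by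
    intro i k l hm
    exact absurd rfl hm.2
  well_defined := by
    intro p hp q hq hc
    have hc' : conflict H.ops p q := conflict_nonmeth _ _ p q hp.2 hq.2 hc
    rcases H.well_defined p hp.1 q hq.1 hc' with h | h
    · exact Or.inl ⟨h, hp.2, hq.2⟩
    · exact Or.inr ⟨h, hq.2, hp.2⟩

/-- `reads(T_i, x, T_j, p)`: transaction `T_i` reads `x` from `T_j` via the operation `p`. -/
def readsVia (H : MCHistory D) (i : ℕ) (x : D) (j : ℕ) (p : MCOp D) : Prop :=
  ∃ h k : ℕ, MCOp.read h k x ∈ H.ops ∧ MCOp.write j x ∈ H.ops ∧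
    H.lt (MCOp.write j x) (MCOp.read h k x) ∧
    ((h = i ∧ p = MCOp.read h k x) ∨
      (h ≠ i ∧ MCOp.meth i h k ∈ H.ops ∧ p = MCOp.meth i h k)) ∧
    ¬ H.lt (MCOp.abort j) (MCOp.read h k x) ∧
    ∀ o : ℕ, MCOp.write o x ∈ H.ops → H.lt (MCOp.write j x) (MCOp.write o x) →
      H.lt (MCOp.write o x) (MCOp.read h k x) →
      H.lt (MCOp.abort o) (MCOp.read h k x)

/-- `H` is recoverable. -/
def Recoverable (H : MCHistory D) : Prop :=
  ∀ (i j : ℕ) (x : D) (p : MCOp D), i ≠ j → H.readsVia i x j p →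
    MCOp.commit i ∈ H.ops → H.lt (MCOp.commit j) (MCOp.commit i)

/-- `H` avoids cascading aborts (ACA). -/
def ACA (H : MCHistory D) : Prop :=
  ∀ (i j : ℕ) (x : D) (p : MCOp D), i ≠ j → H.readsVia i x j p →
    H.lt (MCOp.commit j) p

/-- `H` is strict. -/
def Strict (H : MCHistory D) : Prop :=
  H.ACA ∧ ∀ (i j : ℕ) (x : D), MCOp.write i x ∈ H.ops → MCOp.write j x ∈ H.ops →
    i ≠ j → H.lt (MCOp.write j x) (MCOp.write i x) →
    (H.lt (MCOp.abort j) (MCOp.write i x) ∨ H.lt (MCOp.commit j) (MCOp.write i x))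

/-- The 1-version serializability graph `SG(H)` of an rw-history. -/
def SG (H : MCHistory D) (i j : ℕ) : Prop :=
  i ≠ j ∧ MCOp.commit i ∈ H.ops ∧ MCOp.commit j ∈ H.ops ∧
  ∃ p q : MCOp D, p ∈ H.ops ∧ q ∈ H.ops ∧ p.tx = i ∧ q.tx = j ∧
    conflict H.ops p q ∧ H.lt p q

/-- The MC-serializability graph `MCSG(H)`. -/
def MCSG (H : MCHistory D) (i j : ℕ) : Prop :=
  MCOp.commit i ∈ H.ops ∧ MCOp.commit j ∈ H.ops ∧
  ((∃ p q : MCOp D, p ∈ H.ops ∧ q ∈ H.ops ∧ p.tx = i ∧ q.tx = j ∧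
      p.kind ≠ OpKind.m ∧ q.kind ≠ OpKind.m ∧ conflict H.ops p q ∧ H.lt p q) ∨
   (∃ (k l : ℕ) (x : D), MCOp.meth i k l ∈ H.ops ∧ MCOp.write j x ∈ H.ops ∧
      MCOp.read k l x ∈ H.ops ∧ H.lt (MCOp.read k l x) (MCOp.write j x) ∧
      (i ≠ j ∨ H.lt (MCOp.write j x) (MCOp.meth i k l))) ∨
   (i ≠ j ∧ ∃ (k l : ℕ) (x : D), MCOp.write i x ∈ H.ops ∧ MCOp.meth j k l ∈ H.ops ∧
      MCOp.read k l x ∈ H.ops ∧ H.lt (MCOp.write i x) (MCOp.read k l x)))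

/-- `ts` is a timestamp function for `H`: it assigns pairwise distinct
natural numbers to the transactions of `H`. -/
def TimestampFn (H : MCHistory D) (ts : ℕ → ℕ) : Prop :=
  ∀ i j : ℕ, 1 ≤ i → i ≤ H.n → 1 ≤ j → j ≤ H.n → ts i = ts j → i = j

/-- `H` is t-ordered w.r.t. `ts`. -/
def TOrdered (H : MCHistory D) (ts : ℕ → ℕ) : Prop :=
  ∀ p ∈ H.ops, ∀ q ∈ H.ops, conflict H.ops p q → ts p.tx < ts q.tx →
    (MCOp.abort p.tx ∈ H.ops ∨ MCOp.abort q.tx ∈ H.ops ∨ H.lt p q)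

/-- `H` is rm-ordered w.r.t. `ts`. -/
def RMOrdered (H : MCHistory D) (ts : ℕ → ℕ) : Prop :=
  ∀ (i j k l : ℕ) (x : D), MCOp.write i x ∈ H.ops → MCOp.meth j k l ∈ H.ops →
    MCOp.read k l x ∈ H.ops →
    H.lt (MCOp.write i x) (MCOp.read k l x) →
    H.lt (MCOp.read k l x) (MCOp.meth j k l) →
    (MCOp.abort i ∈ H.ops ∨ MCOp.abort j ∈ H.ops ∨ ts i < ts j)

/-- `H` is irreflexive. -/
def IrreflexiveHist (H : MCHistory D) : Prop :=
  ∀ (i k l : ℕ) (x : D), MCOp.write i x ∈ H.ops → MCOp.meth i k l ∈ H.ops →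
    MCOp.read k l x ∈ H.ops →
    H.lt (MCOp.read k l x) (MCOp.write i x) →
    H.lt (MCOp.write i x) (MCOp.meth i k l) →
    MCOp.abort i ∈ H.ops

/-- `tsfit` satisfies the defining recursion of the fitting timestamp function
`ts_fit` on the committed transactions of `H`. -/
def TsFitSpec (H : MCHistory D) (ts tsfit : ℕ → ℕ) : Prop :=
  ∀ i : ℕ, MCOp.commit i ∈ H.ops →
    tsfit i = sInf (({ts i} : Set ℕ) ∪
      {v : ℕ | ∃ j : ℕ, MCOp.commit j ∈ H.ops ∧ ts j < ts i ∧
        (∃ (k l : ℕ) (x : D), MCOp.write j x ∈ H.ops ∧ MCOp.meth i k l ∈ H.ops ∧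
          MCOp.read k l x ∈ H.ops ∧ H.lt (MCOp.read k l x) (MCOp.write j x)) ∧
        v = tsfit j})

/-- `H` is t-fitting w.r.t. `ts` (with fitting timestamps `tsfit`). -/
def TFitting (H : MCHistory D) (ts tsfit : ℕ → ℕ) : Prop :=
  ∀ i j : ℕ, H.MCSG i j → ts i < ts j → ts i < tsfit j

/-- A reverse edge of `MCSG(H)` w.r.t. `ts`. -/
def RevEdge (H : MCHistory D) (ts : ℕ → ℕ) (i j : ℕ) : Prop :=
  H.MCSG i j ∧ ts j < ts i

end MCHistory
/-! ## Multiversion interpretation `MV(H)` -/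

/-- Superscripts of read operations in `MV(H)`: either original superscripts
(`Sum.inl j`), or fresh superscripts introduced for the reads replacing a method
operation `m_i^{k,l}` (`Sum.inr (Sum.inl (k,l))`), or the fresh superscript of the
companion read of a write operation (`Sum.inr (Sum.inr ())`). -/
abbrev MVSup : Type := ℕ ⊕ ((ℕ × ℕ) ⊕ Unit)

/-- Operations of multiversion histories: `read i h x v` is `r_i^h[x_v]`,
`write i x` is `w_i[x_i]` (a write always writes its own version). -/
inductive MVOp (D : Type) : Type where
  | read (i : ℕ) (h : MVSup) (x : D) (v : ℕ)
  | write (i : ℕ) (x : D)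
  | commit (i : ℕ)
  | abort (i : ℕ)

namespace MVOp
variable {D : Type}

/-- The preimage `mv⁻¹(p)` of a multiversion operation of `MV(H)` in `H`. -/
def pre : MVOp D → MCOp D
  | read i (Sum.inl j) x _ => MCOp.read i j x
  | read i (Sum.inr (Sum.inl kl)) _ _ => MCOp.meth i kl.1 kl.2
  | read i (Sum.inr (Sum.inr _)) x _ => MCOp.write i x
  | write i x => MCOp.write i x
  | commit i => MCOp.commit i
  | abort i => MCOp.abort i

end MVOp

namespace MCHistory
variable {D : Type}

/-- `V(p) = k` for data element `x`: `k` is the index of the last write operation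
`w_k[x] ∈ H` before `p` with `c_k ∈ H`; `k = 0` if no such write exists. -/
def lastWriteIdx (H : MCHistory D) (x : D) (p : MCOp D) (k : ℕ) : Prop :=
  (k = 0 ∧ ∀ o : ℕ, MCOp.write o x ∈ H.ops → MCOp.commit o ∈ H.ops →
      ¬ H.lt (MCOp.write o x) p) ∨
  (MCOp.write k x ∈ H.ops ∧ MCOp.commit k ∈ H.ops ∧ H.lt (MCOp.write k x) p ∧
    ∀ o : ℕ, MCOp.write o x ∈ H.ops → MCOp.commit o ∈ H.ops →
      H.lt (MCOp.write o x) p → (o = k ∨ H.lt (MCOp.write o x) (MCOp.write k x)))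

/-- The operations of the multiversion interpretation `MV(H)` of `H`,
i.e. `⋃_{p ∈ H} mv(p)`. -/
def MVops (H : MCHistory D) : Set (MVOp D) :=
  { q : MVOp D |
    (∃ (i j : ℕ) (x : D) (v : ℕ), MCOp.read i j x ∈ H.ops ∧
        H.lastWriteIdx x (MCOp.read i j x) v ∧ q = MVOp.read i (Sum.inl j) x v) ∨
    (∃ (i : ℕ) (x : D), MCOp.write i x ∈ H.ops ∧ q = MVOp.write i x) ∨
    (∃ (i : ℕ) (x : D) (v : ℕ), MCOp.write i x ∈ H.ops ∧
        (¬ ∃ k : ℕ, MCOp.read i k x ∈ H.ops ∧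
            H.lt (MCOp.read i k x) (MCOp.write i x)) ∧
        H.lastWriteIdx x (MCOp.write i x) v ∧
        q = MVOp.read i (Sum.inr (Sum.inr ())) x v) ∨
    (∃ (i k l : ℕ) (x : D) (v : ℕ), MCOp.meth i k l ∈ H.ops ∧
        MCOp.read k l x ∈ H.ops ∧ H.lastWriteIdx x (MCOp.read k l x) v ∧
        q = MVOp.read i (Sum.inr (Sum.inl (k, l))) x v) ∨
    (∃ i : ℕ, MCOp.commit i ∈ H.ops ∧ q = MVOp.commit i) ∨
    (∃ i : ℕ, MCOp.abort i ∈ H.ops ∧ q = MVOp.abort i) }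

/-- The ordering relation `<'` of `MV(H)`: `p <' q` iff `mv⁻¹(p) < mv⁻¹(q)` in `H`,
or `p` and `q` stem from the same method operation `m_i^{k,l}` and the underlying
reads satisfy `r_k^l[x] < r_k^l[y]`. -/
def mvlt (H : MCHistory D) (p q : MVOp D) : Prop :=
  H.lt p.pre q.pre ∨
  (∃ (i k l : ℕ) (x y : D) (vx vy : ℕ),
      p = MVOp.read i (Sum.inr (Sum.inl (k, l))) x vx ∧
      q = MVOp.read i (Sum.inr (Sum.inl (k, l))) y vy ∧
      H.lt (MCOp.read k l x) (MCOp.read k l y))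

end MCHistory

/-- `vlt` is a version order: for every data element it totally orders the
versions, with version `0` (the initial version) as the smallest one. -/
def IsVersionOrder {D : Type} (vlt : D → ℕ → ℕ → Prop) : Prop :=
  (∀ (x : D) (i : ℕ), ¬ vlt x i i) ∧
  (∀ (x : D) (i j k : ℕ), vlt x i j → vlt x j k → vlt x i k) ∧
  (∀ (x : D) (i : ℕ), i ≠ 0 → vlt x 0 i) ∧
  (∀ (x : D) (i j : ℕ), i ≠ 0 → j ≠ 0 → i ≠ j → vlt x i j ∨ vlt x j i)

namespace MCHistory
variable {D : Type}

/-- `vlt` is a write version order for `MV(H)`: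
`w_i[x_i] <' w_j[x_j] ∨ i = 0` implies `x_i ≪ x_j`. -/
def IsWriteVersionOrder (H : MCHistory D) (vlt : D → ℕ → ℕ → Prop) : Prop :=
  ∀ (i j : ℕ) (x : D), MVOp.write i x ∈ H.MVops → MVOp.write j x ∈ H.MVops →
    (H.mvlt (MVOp.write i x) (MVOp.write j x) ∨ i = 0) → vlt x i j

/-- The multiversion serializability graph `MVSG` of `MV(H)` w.r.t. the
version order `vlt`: there is an edge `T_i → T_j` iff both transactions are committed
and there are operations `r_k^h[x_l], w_m[x_m] ∈ MV(H)` realizing one of the four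
defining clauses. -/
def MVSG (H : MCHistory D) (vlt : D → ℕ → ℕ → Prop) (i j : ℕ) : Prop :=
  MVOp.commit i ∈ H.MVops ∧ MVOp.commit j ∈ H.MVops ∧
  ∃ (k : ℕ) (h : MVSup) (x : D) (l m : ℕ),
    MVOp.read k h x l ∈ H.MVops ∧ MVOp.write m x ∈ H.MVops ∧
    ((i = j ∧ j = k ∧ k = m ∧ i ≠ l ∧ H.mvlt (MVOp.write i x) (MVOp.read i h x l)) ∨
     (i ≠ j ∧ m = i ∧ i = l ∧ k = j) ∨
     (i ≠ j ∧ m = i ∧ l = j ∧ vlt x m l) ∨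
     (i ≠ j ∧ k = i ∧ m = j ∧ vlt x l m))

end MCHistory

namespace MCHistory
variable {D : Type} {H : MCHistory D}

/-- `p` is the operation of `H` whose position determines the version read by
`r_k^h[x_v]` in `MV(H)`: the read itself, the write it accompanies, or the read
`r_a^b[x]` underlying the method operation `m_k^{a,b}`. -/
def ReadSource (H : MCHistory D) (k : ℕ) (h : MVSup) (x : D) (p : MCOp D) : Prop :=
  (∃ j, h = Sum.inl j ∧ p = MCOp.read k j x ∧ MCOp.read k j x ∈ H.ops) ∨
  (h = Sum.inr (Sum.inr ()) ∧ p = MCOp.write k x ∧ MCOp.write k x ∈ H.ops ∧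
    ¬ ∃ j, MCOp.read k j x ∈ H.ops ∧ H.lt (MCOp.read k j x) (MCOp.write k x)) ∨
  (∃ a b, h = Sum.inr (Sum.inl (a, b)) ∧ p = MCOp.read a b x ∧
    MCOp.meth k a b ∈ H.ops ∧ MCOp.read a b x ∈ H.ops)

theorem read_mem_MVops {k : ℕ} {h : MVSup} {x : D} {v : ℕ} :
    MVOp.read k h x v ∈ H.MVops ↔ ∃ p, H.ReadSource k h x p ∧ H.lastWriteIdx x p v := by
  constructor
  · rintro (⟨i, j, y, u, hr, hv, e⟩ | ⟨i, y, -, e⟩ | ⟨i, y, u, hw, hn, hv, e⟩ |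
      ⟨i, a, b, y, u, hm, hr, hv, e⟩ | ⟨i, -, e⟩ | ⟨i, -, e⟩) <;> cases e
    · exact ⟨_, Or.inl ⟨j, rfl, rfl, hr⟩, hv⟩
    · exact ⟨_, Or.inr (Or.inl ⟨rfl, rfl, hw, hn⟩), hv⟩
    · exact ⟨_, Or.inr (Or.inr ⟨a, b, rfl, rfl, hm, hr⟩), hv⟩
  · rintro ⟨p, ⟨j, rfl, rfl, hr⟩ | ⟨rfl, rfl, hw, hn⟩ | ⟨a, b, rfl, rfl, hm, hr⟩, hv⟩
    · exact Or.inl ⟨k, j, x, v, hr, hv, rfl⟩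
    · exact Or.inr (Or.inr (Or.inl ⟨k, x, v, hw, hn, hv, rfl⟩))
    · exact Or.inr (Or.inr (Or.inr (Or.inl ⟨k, a, b, x, v, hm, hr, hv, rfl⟩)))

theorem write_mem_MVops {i : ℕ} {x : D} :
    MVOp.write i x ∈ H.MVops ↔ MCOp.write i x ∈ H.ops := by
  simp [MVops]

theorem commit_mem_MVops {i : ℕ} : MVOp.commit i ∈ H.MVops ↔ MCOp.commit i ∈ H.ops := by
  simp [MVops]

theorem ne_zero_of_mem {p : MCOp D} (hp : p ∈ H.ops) : p.tx ≠ 0 :=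
  Nat.one_le_iff_ne_zero.mp (H.tx_mem p hp).1

theorem write_lt_or_lt_write {i j : ℕ} {x : D} (hi : MCOp.write i x ∈ H.ops)
    (hj : MCOp.write j x ∈ H.ops) (hij : i ≠ j) :
    H.lt (MCOp.write i x) (MCOp.write j x) ∨ H.lt (MCOp.write j x) (MCOp.write i x) :=
  H.well_defined _ hi _ hj ⟨by simp [dset], Or.inl ⟨hij, Or.inl rfl⟩⟩

theorem read_lt_or_lt_write {a b j : ℕ} {x : D} (hr : MCOp.read a b x ∈ H.ops)
    (hw : MCOp.write j x ∈ H.ops) :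
    H.lt (MCOp.read a b x) (MCOp.write j x) ∨ H.lt (MCOp.write j x) (MCOp.read a b x) := by
  rcases eq_or_ne a j with rfl | h
  · have := H.rw_order a b x hr hw
    tauto
  · exact H.well_defined _ hr _ hw ⟨by simp [dset], Or.inl ⟨h, Or.inr rfl⟩⟩

theorem ReadSource.lt_or_lt_write {k j : ℕ} {h : MVSup} {x : D} {p : MCOp D}
    (hp : H.ReadSource k h x p) (hw : MCOp.write j x ∈ H.ops) (hkj : k ≠ j) :
    H.lt p (MCOp.write j x) ∨ H.lt (MCOp.write j x) p := by
  rcases hp with ⟨b, -, rfl, hr⟩ | ⟨-, rfl, hk, -⟩ | ⟨a, b, -, rfl, -, hr⟩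
  · exact read_lt_or_lt_write hr hw
  · exact write_lt_or_lt_write hk hw hkj
  · exact read_lt_or_lt_write hr hw

theorem exists_lastWriteIdx (H : MCHistory D) (x : D) (p : MCOp D) :
    ∃ v, H.lastWriteIdx x p v := by
  set S : Set ℕ := {o | MCOp.write o x ∈ H.ops ∧ MCOp.commit o ∈ H.ops ∧
    H.lt (MCOp.write o x) p}
  have hfin : S.Finite := (Set.finite_Iic H.n).subset fun o ho => (H.tx_mem _ ho.1).2
  rcases S.eq_empty_or_nonempty with hS | hS
  · exact ⟨0, Or.inl ⟨rfl, fun o h1 h2 h3 => Set.eq_empty_iff_forall_notMem.mp hS o ⟨h1, h2, h3⟩⟩⟩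
  · let r : ℕ → ℕ → Prop := fun a b => H.lt (MCOp.write b x) (MCOp.write a x)
    have : IsStrictOrder ℕ r :=
      { irrefl := fun a => H.lt_irrefl _
        trans := fun a b c h1 h2 => H.lt_trans _ _ _ h2 h1 }
    obtain ⟨⟨k, hk⟩, -, hmin⟩ :=
      (hfin.wellFoundedOn (r := r)).has_min Set.univ ⟨⟨hS.some, hS.some_mem⟩, trivial⟩
    refine ⟨k, Or.inr ⟨hk.1, hk.2.1, hk.2.2, fun o h1 h2 h3 => ?_⟩⟩
    refine or_iff_not_imp_left.2 fun hok => (write_lt_or_lt_write h1 hk.1 hok).resolve_right ?_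
    exact hmin ⟨o, h1, h2, h3⟩ trivial

theorem lastWriteIdx.vlt_of_lt_write {vlt : D → ℕ → ℕ → Prop} (hvo : IsVersionOrder vlt)
    (hwvo : H.IsWriteVersionOrder vlt) {x : D} {p : MCOp D} {v j : ℕ}
    (hv : H.lastWriteIdx x p v) (hp : H.lt p (MCOp.write j x))
    (hw : MCOp.write j x ∈ H.ops) : vlt x v j := by
  rcases hv with ⟨rfl, -⟩ | ⟨hv, -, hlt, -⟩
  · exact hvo.2.2.1 x j (ne_zero_of_mem hw)
  · exact hwvo v j x (write_mem_MVops.2 hv) (write_mem_MVops.2 hw)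
      (Or.inl (Or.inl (H.lt_trans _ _ _ hlt hp)))

/-- Every write in `H` has a read of the same element and transaction in `MV(H)` that does not
come after it. -/
theorem exists_readSource_of_write {i : ℕ} {x : D} (hw : MCOp.write i x ∈ H.ops) :
    ∃ h p, H.ReadSource i h x p ∧ (p = MCOp.write i x ∨ H.lt p (MCOp.write i x)) := by
  by_cases hr : ∃ j, MCOp.read i j x ∈ H.ops ∧ H.lt (MCOp.read i j x) (MCOp.write i x)
  · obtain ⟨j, hj, hlt⟩ := hr
    exact ⟨_, _, Or.inl ⟨j, rfl, rfl, hj⟩, Or.inr hlt⟩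
  · exact ⟨_, _, Or.inr (Or.inl ⟨rfl, rfl, hw, hr⟩), Or.inl rfl⟩

theorem MCSG_of_write_lt {i k : ℕ} {h : MVSup} {x : D} {p : MCOp D}
    (ci : MCOp.commit i ∈ H.ops) (ck : MCOp.commit k ∈ H.ops) (hik : i ≠ k)
    (hp : H.ReadSource k h x p) (hlt : H.lt (MCOp.write i x) p) : H.MCSG i k := by
  have hw := (H.lt_mem _ _ hlt).1
  refine ⟨ci, ck, ?_⟩
  rcases hp with ⟨b, -, rfl, hr⟩ | ⟨-, rfl, hk, -⟩ | ⟨a, b, -, rfl, hm, hr⟩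
  · exact Or.inl ⟨_, _, hw, hr, rfl, rfl, by simp [MCOp.kind], by simp [MCOp.kind],
      ⟨by simp [dset], Or.inl ⟨hik, Or.inl rfl⟩⟩, hlt⟩
  · exact Or.inl ⟨_, _, hw, hk, rfl, rfl, by simp [MCOp.kind], by simp [MCOp.kind],
      ⟨by simp [dset], Or.inl ⟨hik, Or.inl rfl⟩⟩, hlt⟩
  · exact Or.inr (Or.inr ⟨hik, a, b, x, hw, hm, hr, hlt⟩)

theorem MCSG_of_lt_write {k j : ℕ} {h : MVSup} {x : D} {p : MCOp D}
    (ck : MCOp.commit k ∈ H.ops) (cj : MCOp.commit j ∈ H.ops) (hkj : k ≠ j)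
    (hp : H.ReadSource k h x p) (hlt : H.lt p (MCOp.write j x)) : H.MCSG k j := by
  have hw := (H.lt_mem _ _ hlt).2
  refine ⟨ck, cj, ?_⟩
  rcases hp with ⟨b, -, rfl, hr⟩ | ⟨-, rfl, hk, -⟩ | ⟨a, b, -, rfl, hm, hr⟩
  · exact Or.inl ⟨_, _, hr, hw, rfl, rfl, by simp [MCOp.kind], by simp [MCOp.kind],
      ⟨by simp [dset], Or.inl ⟨hkj, Or.inr rfl⟩⟩, hlt⟩
  · exact Or.inl ⟨_, _, hk, hw, rfl, rfl, by simp [MCOp.kind], by simp [MCOp.kind],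
      ⟨by simp [dset], Or.inl ⟨hkj, Or.inr rfl⟩⟩, hlt⟩
  · exact Or.inr (Or.inl ⟨a, b, x, hm, hw, hr, hlt, Or.inl hkj⟩)

theorem MCSG_of_write_lt_write {i j : ℕ} {x : D}
    (ci : MCOp.commit i ∈ H.ops) (cj : MCOp.commit j ∈ H.ops)
    (hlt : H.lt (MCOp.write i x) (MCOp.write j x)) : H.MCSG i j := by
  have hij : i ≠ j := by
    rintro rfl
    exact H.lt_irrefl _ hlt
  have hmem := H.lt_mem _ _ hlt
  exact ⟨ci, cj, Or.inl ⟨_, _, hmem.1, hmem.2, rfl, rfl, by simp [MCOp.kind],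
    by simp [MCOp.kind], ⟨by simp [dset], Or.inl ⟨hij, Or.inl rfl⟩⟩, hlt⟩⟩

theorem IsWriteVersionOrder.write_lt_of_vlt {vlt : D → ℕ → ℕ → Prop}
    (hvo : IsVersionOrder vlt) (hwvo : H.IsWriteVersionOrder vlt) {x : D} {i j : ℕ}
    (hi : MCOp.write i x ∈ H.ops) (hj : MCOp.write j x ∈ H.ops) (h : vlt x i j) :
    H.lt (MCOp.write i x) (MCOp.write j x) := by
  have hij : i ≠ j := by
    rintro rfl
    exact hvo.1 x i h
  refine (write_lt_or_lt_write hi hj hij).resolve_right fun hji => ?_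
  exact hvo.1 x i (hvo.2.1 x i j i h
    (hwvo j i x (write_mem_MVops.2 hj) (write_mem_MVops.2 hi) (Or.inl (Or.inl hji))))

theorem lastWriteIdx.write_lt {x : D} {p : MCOp D} {v : ℕ}
    (hv : H.lastWriteIdx x p v) (h0 : v ≠ 0) :
    MCOp.commit v ∈ H.ops ∧ H.lt (MCOp.write v x) p := by
  rcases hv with ⟨h, -⟩ | ⟨-, hc, hlt, -⟩
  · exact absurd h h0
  · exact ⟨hc, hlt⟩

/-- If the committed write `w_i[x]` precedes `p` and is not the last such write, then the last
one is a committed write after `w_i[x]`. -/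
theorem lastWriteIdx.write_lt_of_ne {x : D} {p : MCOp D} {v i : ℕ}
    (hv : H.lastWriteIdx x p v) (ci : MCOp.commit i ∈ H.ops)
    (hlt : H.lt (MCOp.write i x) p) (hiv : i ≠ v) :
    MCOp.commit v ∈ H.ops ∧ H.lt (MCOp.write v x) p ∧
      H.lt (MCOp.write i x) (MCOp.write v x) := by
  have hw := (H.lt_mem _ _ hlt).1
  rcases hv with ⟨-, hn⟩ | ⟨-, hc, hvp, hmax⟩
  · exact absurd hlt (hn i hw ci)
  · exact ⟨hc, hvp, (hmax i hw ci hlt).resolve_left hiv⟩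

theorem transGen_MCSG_of_MVSG_self {i l : ℕ} {h : MVSup} {x : D}
    (ci : MCOp.commit i ∈ H.ops) (hr : MVOp.read i h x l ∈ H.MVops)
    (hil : i ≠ l) (hlt : H.mvlt (MVOp.write i x) (MVOp.read i h x l)) :
    Relation.TransGen H.MCSG i i := by
  obtain ⟨p, hp, hv⟩ := read_mem_MVops.1 hr
  have hlt : H.lt (MCOp.write i x) (MVOp.read i h x l).pre := by
    rcases hlt with hlt | ⟨_, _, _, _, _, _, _, e, -⟩
    · exact hlt
    · cases e
  have key : H.lt (MCOp.write i x) p → Relation.TransGen H.MCSG i i := fun hip => by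
    obtain ⟨cl, hlp, hil'⟩ := hv.write_lt_of_ne ci hip hil
    exact .tail (.single (MCSG_of_write_lt_write ci cl hil'))
      (MCSG_of_write_lt cl ci hil.symm hp hlp)
  rcases hp with ⟨b, rfl, rfl, -⟩ | ⟨rfl, rfl, -⟩ | ⟨a, b, rfl, rfl, hm, hab⟩
  · exact key hlt
  · exact absurd hlt (H.lt_irrefl _)
  · have hw := (H.lt_mem _ _ hlt).1
    rcases read_lt_or_lt_write hab hw with hrw | hwr
    · exact .single ⟨ci, ci, Or.inr (Or.inl ⟨a, b, x, hm, hw, hab, hrw, Or.inr hlt⟩)⟩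
    · exact key hwr

theorem transGen_MCSG_of_MVSG {vlt : D → ℕ → ℕ → Prop} (hvo : IsVersionOrder vlt)
    (hwvo : H.IsWriteVersionOrder vlt) {i j : ℕ} (hij : H.MVSG vlt i j) :
    Relation.TransGen H.MCSG i j := by
  obtain ⟨ci, cj, k, h, x, l, m, hr, hw, hcase⟩ := hij
  rw [commit_mem_MVops] at ci cj
  rw [write_mem_MVops] at hw
  rcases hcase with ⟨rfl, rfl, rfl, hil, hlt⟩ | ⟨hij, rfl, rfl, rfl⟩ | ⟨hij, rfl, rfl, hvlt⟩ |
    ⟨hij, rfl, rfl, hvlt⟩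
  · exact transGen_MCSG_of_MVSG_self ci hr hil hlt
  · obtain ⟨p, hp, hv⟩ := read_mem_MVops.1 hr
    exact .single (MCSG_of_write_lt ci cj hij hp (hv.write_lt (ne_zero_of_mem hw)).2)
  · obtain ⟨p, hp, hv⟩ := read_mem_MVops.1 hr
    have hlw := (H.lt_mem _ _ (hv.write_lt (ne_zero_of_mem cj)).2).1
    exact .single (MCSG_of_write_lt_write ci cj (hwvo.write_lt_of_vlt hvo hw hlw hvlt))
  · obtain ⟨p, hp, hv⟩ := read_mem_MVops.1 hr
    refine .single (MCSG_of_lt_write ci cj hij hp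
      ((hp.lt_or_lt_write hw hij).resolve_right fun hmp => ?_))
    have hml : m ≠ l := by
      rintro rfl
      exact hvo.1 x _ hvlt
    have hlt := (hv.write_lt_of_ne cj hmp hml).2.2
    exact hvo.1 x l (hvo.2.1 x l m l hvlt (hwvo m l x (write_mem_MVops.2 hw)
      (write_mem_MVops.2 (H.lt_mem _ _ hlt).2) (Or.inl (Or.inl hlt))))

theorem MVSG_of_lt_write {vlt : D → ℕ → ℕ → Prop} (hvo : IsVersionOrder vlt)
    (hwvo : H.IsWriteVersionOrder vlt) {k j : ℕ} {h : MVSup} {x : D} {p : MCOp D}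
    (ck : MCOp.commit k ∈ H.ops) (cj : MCOp.commit j ∈ H.ops) (hkj : k ≠ j)
    (hp : H.ReadSource k h x p) (hlt : H.lt p (MCOp.write j x)) : H.MVSG vlt k j := by
  have hw := (H.lt_mem _ _ hlt).2
  obtain ⟨v, hv⟩ := H.exists_lastWriteIdx x p
  exact ⟨commit_mem_MVops.2 ck, commit_mem_MVops.2 cj, k, h, x, v, j,
    read_mem_MVops.2 ⟨p, hp, hv⟩, write_mem_MVops.2 hw,
    Or.inr (Or.inr (Or.inr ⟨hkj, rfl, rfl, hv.vlt_of_lt_write hvo hwvo hlt hw⟩))⟩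

theorem MVSG_of_write_lt_write {vlt : D → ℕ → ℕ → Prop} (hvo : IsVersionOrder vlt)
    (hwvo : H.IsWriteVersionOrder vlt) {i j : ℕ} {x : D}
    (ci : MCOp.commit i ∈ H.ops) (cj : MCOp.commit j ∈ H.ops)
    (hlt : H.lt (MCOp.write i x) (MCOp.write j x)) : H.MVSG vlt i j := by
  have hij : i ≠ j := by
    rintro rfl
    exact H.lt_irrefl _ hlt
  obtain ⟨h, p, hp, rfl | hpi⟩ := exists_readSource_of_write (H.lt_mem _ _ hlt).1
  · exact MVSG_of_lt_write hvo hwvo ci cj hij hp hlt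
  · exact MVSG_of_lt_write hvo hwvo ci cj hij hp (H.lt_trans _ _ _ hpi hlt)

theorem transGen_MVSG_of_write_lt {vlt : D → ℕ → ℕ → Prop} (hvo : IsVersionOrder vlt)
    (hwvo : H.IsWriteVersionOrder vlt) {i k : ℕ} {h : MVSup} {x : D} {p : MCOp D}
    (ci : MCOp.commit i ∈ H.ops) (ck : MCOp.commit k ∈ H.ops) (hik : i ≠ k)
    (hp : H.ReadSource k h x p) (hlt : H.lt (MCOp.write i x) p) :
    Relation.TransGen (H.MVSG vlt) i k := by
  obtain ⟨v, hv⟩ := H.exists_lastWriteIdx x p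
  have readsFrom : ∀ o, MCOp.commit o ∈ H.ops → H.lt (MCOp.write o x) p → o ≠ k → o = v →
      H.MVSG vlt o k := by
    rintro o co hop hok rfl
    exact ⟨commit_mem_MVops.2 co, commit_mem_MVops.2 ck, k, h, x, o, o,
      read_mem_MVops.2 ⟨p, hp, hv⟩, write_mem_MVops.2 (H.lt_mem _ _ hop).1,
      Or.inr (Or.inl ⟨hok, rfl, rfl, rfl⟩)⟩
  rcases eq_or_ne i v with hiv | hiv
  · exact .single (readsFrom i ci hlt hik hiv)
  · obtain ⟨cv, hvp, hlt'⟩ := hv.write_lt_of_ne ci hlt hiv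
    have hedge := MVSG_of_write_lt_write hvo hwvo ci cv hlt'
    rcases eq_or_ne v k with rfl | hvk
    · exact .single hedge
    · exact .tail (.single hedge) (readsFrom v cv hvp hvk rfl)

theorem transGen_MVSG_of_MCSG {vlt : D → ℕ → ℕ → Prop} (hvo : IsVersionOrder vlt)
    (hwvo : H.IsWriteVersionOrder vlt) {i j : ℕ} (hij : H.MCSG i j) :
    Relation.TransGen (H.MVSG vlt) i j := by
  obtain ⟨ci, cj, ⟨p, q, hp, hq, rfl, rfl, hpm, hqm, ⟨⟨x, hxp, hxq⟩, hc⟩, hlt⟩ |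
    ⟨a, b, x, hm, hw, hr, hlt, hij⟩ | ⟨hij, a, b, x, hw, hm, hr, hlt⟩⟩ := hij
  · obtain ⟨htx, hkind⟩ : p.tx ≠ q.tx ∧ (p.kind = OpKind.w ∨ q.kind = OpKind.w) := by tauto
    cases p <;> cases q <;> simp [dset, MCOp.kind] at hxp hxq hpm hqm hkind <;> subst hxp hxq
    · exact .single (MVSG_of_lt_write hvo hwvo ci cj htx (Or.inl ⟨_, rfl, rfl, hp⟩) hlt)
    · exact transGen_MVSG_of_write_lt hvo hwvo ci cj htx (Or.inl ⟨_, rfl, rfl, hq⟩) hlt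
    · exact .single (MVSG_of_write_lt_write hvo hwvo ci cj hlt)
  · have hp : H.ReadSource i _ x _ := Or.inr (Or.inr ⟨a, b, rfl, rfl, hm, hr⟩)
    rcases eq_or_ne i j with rfl | hne
    · obtain ⟨v, hv⟩ := H.exists_lastWriteIdx x (MCOp.read a b x)
      have hiv : i ≠ v := by
        rintro rfl
        exact hvo.1 x i (hv.vlt_of_lt_write hvo hwvo hlt hw)
      exact .single ⟨commit_mem_MVops.2 ci, commit_mem_MVops.2 ci, i, _, x, v, i,
        read_mem_MVops.2 ⟨_, hp, hv⟩, write_mem_MVops.2 hw,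
        Or.inl ⟨rfl, rfl, rfl, hiv, Or.inl (hij.resolve_left fun h => h rfl)⟩⟩
    · exact .single (MVSG_of_lt_write hvo hwvo ci cj hne hp hlt)
  · exact transGen_MVSG_of_write_lt hvo hwvo ci cj hij
      (Or.inr (Or.inr ⟨a, b, rfl, rfl, hm, hr⟩)) hlt

end MCHistory

/-- Theorem 2 of the paper. For an MC-history `H` and any write
version order, the transitive closure of the MC-serializability graph of `H` equals
the transitive closure of the multiversion serializability graph of `MV(H)`. -/
theorem mcsg_transClosure_eq_mvsg_transClosure {D : Type} (H : MCHistory D)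
    (vlt : D → ℕ → ℕ → Prop)
    (hvo : IsVersionOrder vlt) (hwvo : H.IsWriteVersionOrder vlt) :
    ∀ i j : ℕ, Relation.TransGen H.MCSG i j ↔ Relation.TransGen (H.MVSG vlt) i j := by
  intro i j
  exact ⟨fun h => h.trans_induction_on (MCHistory.transGen_MVSG_of_MCSG hvo hwvo)
      fun _ _ => Relation.TransGen.trans,
    fun h => h.trans_induction_on (MCHistory.transGen_MCSG_of_MVSG hvo hwvo)
      fun _ _ => Relation.TransGen.trans⟩
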